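/- Let a and b be elements of a commutative ring of characteristic 2. With u_n = ⟨W_n⟩, v_n = ⟨W_n'⟩, X_n = A·u_n^4 + B·u_n^3·v_n + C·u_n^2·v_n^2 + v_n^4 where A = ab + b^2 + 1, B = ab(a+b), C = ab, the following recurrence holds for all n ≥ 1: X_{n+1} + 1 = ε_n^4·u_n^4·(X_n + 1) + ε_n^3·u_n^4·(a + b)·(1 + ab·u_n^2), where ε_n = a if n is even and ε_n = b if n is odd. -/

import Mathlib

/-- The continuant `⟨W⟩` of a finite word `W` with letters in a commutative ring,
defined by `⟨∅⟩ = 1`, `⟨w⟩ = w` and `⟨W⟩ = w₁⟨W'⟩ + ⟨(W')'⟩`, where `W'` is `W`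
with its first letter deleted. -/
def continuant {R : Type*} [CommRing R] : List R → R
  | [] => 1
  | [x] => x
  | x :: y :: l => x * continuant (y :: l) + continuant l

/-- The morphism `σ` with `σ(a) = ab`, `σ(b) = aa`, on the abstract two-letter
alphabet `Bool` (where `false` stands for `a` and `true` for `b`), extended to
words by concatenation. -/
def pdStep (l : List Bool) : List Bool :=
  l.flatMap fun x => bif x then [false, false] else [false, true]

/-- The abstract word `Wₙ = (σⁿ(a))''`: the word `σⁿ(a)` with its last letter
removed. -/
def pdWordBool (n : ℕ) : List Bool := (pdStep^[n] [false]).dropLast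

/-- The word `Wₙ = (σⁿ(a))''` with letters the elements `a`, `b` of a ring. -/
def pdWord {R : Type*} (a b : R) (n : ℕ) : List R :=
  (pdWordBool n).map fun x => bif x then b else a

theorem pdStep_append (l m : List Bool) : pdStep (l ++ m) = pdStep l ++ pdStep m := by
  simp [pdStep]

theorem pdStep_iterate_append (n : ℕ) (l m : List Bool) :
    pdStep^[n] (l ++ m) = pdStep^[n] l ++ pdStep^[n] m := by
  induction n generalizing l m with
  | zero => rfl
  | succ n ih => simp only [Function.iterate_succ_apply, pdStep_append, ih]

theorem pdStep_iterate_singleton_succ (n : ℕ) (x : Bool) :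
    pdStep^[n + 1] [x] = pdStep^[n] [false] ++ pdStep^[n] [!x] := by
  rw [← pdStep_iterate_append, Function.iterate_succ_apply]
  cases x <;> rfl

/-- The words `σⁿ(a)` and `σⁿ(b)` agree except in their last letters. -/
theorem pdStep_iterate_singleton (n : ℕ) (x : Bool) :
    pdStep^[n] [x] = pdWordBool n ++ [x ^^ n.bodd] := by
  induction n generalizing x with
  | zero => simp [pdWordBool]
  | succ n ih =>
    rw [pdWordBool, pdStep_iterate_singleton_succ, pdStep_iterate_singleton_succ]
    simp only [ih, ← List.append_assoc, List.dropLast_concat]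
    simp

theorem pdWordBool_succ (n : ℕ) :
    pdWordBool (n + 1) = pdWordBool n ++ n.bodd :: pdWordBool n := by
  rw [pdWordBool, pdStep_iterate_singleton_succ, pdStep_iterate_singleton,
    pdStep_iterate_singleton, ← List.append_assoc, List.dropLast_concat]
  simp

theorem pdWord_zero {R : Type*} (a b : R) : pdWord a b 0 = [] := rfl

theorem pdWord_succ {R : Type*} (a b : R) (n : ℕ) :
    pdWord a b (n + 1) = pdWord a b n ++ (if Even n then a else b) :: pdWord a b n := by
  have h : (bif n.bodd then b else a) = if Even n then a else b := by
    cases hb : n.bodd <;> simp [Nat.even_iff, Nat.mod_two_of_bodd, hb]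
  simp [pdWord, pdWordBool_succ, ← h]

/-- The product of the matrices `!![w, 1; 1, 0]` over the letters `w` of a word. -/
def continuantMatrix {R : Type*} [CommRing R] (l : List R) : Matrix (Fin 2) (Fin 2) R :=
  (l.map fun w => !![w, 1; 1, 0]).prod

theorem continuantMatrix_cons {R : Type*} [CommRing R] (x : R) (l : List R) :
    continuantMatrix (x :: l) = !![x, 1; 1, 0] * continuantMatrix l := by
  simp [continuantMatrix]

theorem continuantMatrix_append {R : Type*} [CommRing R] (l m : List R) :
    continuantMatrix (l ++ m) = continuantMatrix l * continuantMatrix m := by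
  simp [continuantMatrix]

theorem continuantMatrix_cons_one_zero {R : Type*} [CommRing R] (x : R) (l : List R) :
    continuantMatrix (x :: l) 1 0 = continuantMatrix l 0 0 := by
  simp [continuantMatrix_cons, Matrix.mul_apply, Fin.sum_univ_two]

theorem continuantMatrix_zero_zero {R : Type*} [CommRing R] (l : List R) :
    continuantMatrix l 0 0 = continuant l := by
  induction l using continuant.induct with
  | case1 => simp [continuantMatrix, continuant]
  | case2 x => simp [continuantMatrix, continuant]
  | case3 x y l ih₁ ih₂ =>
    rw [continuant, ← ih₁, ← ih₂, ← continuantMatrix_cons_one_zero y l,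
      continuantMatrix_cons x]
    simp [Matrix.mul_apply, Fin.sum_univ_two]

theorem continuantMatrix_one_zero {R : Type*} [CommRing R] {l : List R} (hl : l ≠ []) :
    continuantMatrix l 1 0 = continuant l.tail := by
  cases l with
  | nil => exact absurd rfl hl
  | cons x l => rw [continuantMatrix_cons_one_zero, continuantMatrix_zero_zero, List.tail_cons]

theorem det_continuantMatrix {R : Type*} [CommRing R] (l : List R) :
    (continuantMatrix l).det = (-1) ^ l.length := by
  induction l with
  | nil => simp [continuantMatrix]
  | cons x l ih =>
    rw [continuantMatrix_cons, Matrix.det_mul, ih]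
    simp [Matrix.det_fin_two, pow_succ]

theorem continuantMatrix_pdWord_succ {R : Type*} [CommRing R] (a b : R) (n : ℕ) :
    continuantMatrix (pdWord a b (n + 1)) = continuantMatrix (pdWord a b n) *
      (!![if Even n then a else b, 1; 1, 0] * continuantMatrix (pdWord a b n)) := by
  rw [pdWord_succ, continuantMatrix_append, continuantMatrix_cons]

theorem continuantMatrix_pdWord_isSymm {R : Type*} [CommRing R] (a b : R) (n : ℕ) :
    (continuantMatrix (pdWord a b n)).IsSymm := by
  induction n with
  | zero => simp [pdWord_zero, continuantMatrix]
  | succ n ih =>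
    have h (e : R) : (!![e, 1; 1, 0] : Matrix (Fin 2) (Fin 2) R).transpose = !![e, 1; 1, 0] := by
      ext i j
      fin_cases i <;> fin_cases j <;> rfl
    rw [Matrix.IsSymm, continuantMatrix_pdWord_succ, Matrix.transpose_mul, Matrix.transpose_mul,
      ih.eq, h, mul_assoc]

theorem continuant_pdWord_succ {R : Type*} [CommRing R] [CharP R 2] (a b : R) (n : ℕ) :
    continuant (pdWord a b (n + 1)) =
      (if Even n then a else b) * continuant (pdWord a b n) ^ 2 := by
  have hs := (continuantMatrix_pdWord_isSymm a b n).apply 0 1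
  simp only [← continuantMatrix_zero_zero, continuantMatrix_pdWord_succ]
  simp only [Matrix.mul_apply, Fin.sum_univ_two, Matrix.of_apply, Matrix.cons_val',
    Matrix.cons_val_zero, Matrix.cons_val_one, Matrix.cons_val_fin_one, ← hs]
  linear_combination continuantMatrix (pdWord a b n) 0 0 * continuantMatrix (pdWord a b n) 1 0 *
    CharTwo.two_eq_zero (R := R)

theorem continuant_tail_pdWord_succ {R : Type*} [CommRing R] [CharP R 2] (a b : R) {n : ℕ}
    (hn : 1 ≤ n) :
    continuant (pdWord a b (n + 1)).tail = (if Even n then a else b) *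
      continuant (pdWord a b n) * continuant (pdWord a b n).tail + 1 := by
  have hne (m : ℕ) : pdWord a b (m + 1) ≠ [] := by simp [pdWord_succ]
  obtain ⟨k, rfl⟩ := Nat.exists_eq_add_of_le' hn
  have hs := (continuantMatrix_pdWord_isSymm a b (k + 1)).apply 0 1
  have hd := det_continuantMatrix (pdWord a b (k + 1))
  rw [CharTwo.neg_eq, one_pow, Matrix.det_fin_two, ← hs] at hd
  rw [← continuantMatrix_one_zero (hne _), ← continuantMatrix_one_zero (hne _),
    ← continuantMatrix_zero_zero, continuantMatrix_pdWord_succ]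
  simp only [Matrix.mul_apply, Fin.sum_univ_two, Matrix.of_apply, Matrix.cons_val',
    Matrix.cons_val_zero, Matrix.cons_val_one, Matrix.cons_val_fin_one]
  linear_combination hd + continuantMatrix (pdWord a b (k + 1)) 1 0 ^ 2 *
    CharTwo.two_eq_zero (R := R)

/-- Let `a`, `b` be elements of a commutative ring of characteristic 2.  With
`uₙ = ⟨Wₙ⟩`, `vₙ = ⟨Wₙ'⟩` and `Xₙ = A·uₙ⁴ + B·uₙ³·vₙ + C·uₙ²·vₙ² + vₙ⁴`, where
`A = ab + b² + 1`, `B = ab(a+b)`, `C = ab`, the following recurrence holds for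
all `n ≥ 1`:
`X_{n+1} + 1 = εₙ⁴·uₙ⁴·(Xₙ + 1) + εₙ³·uₙ⁴·(a+b)·(1 + ab·uₙ²)`,
where `εₙ = a` if `n` is even and `εₙ = b` if `n` is odd. -/
theorem pd_X_recurrence
    {R : Type*} [CommRing R] [CharP R 2] (a b : R)
    (u v X : ℕ → R)
    (hu : ∀ n, u n = continuant (pdWord a b n))
    (hv : ∀ n, v n = continuant (pdWord a b n).tail)
    (hX : ∀ n, X n = (a * b + b ^ 2 + 1) * u n ^ 4 + (a * b * (a + b)) * u n ^ 3 * v n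
      + (a * b) * u n ^ 2 * v n ^ 2 + v n ^ 4) :
    ∀ n : ℕ, 1 ≤ n →
      X (n + 1) + 1 =
        (if Even n then a else b) ^ 4 * u n ^ 4 * (X n + 1)
          + (if Even n then a else b) ^ 3 * u n ^ 4 * (a + b) * (1 + a * b * u n ^ 2) := by
  intro n hn
  have h2 : (2 : R) = 0 := CharTwo.two_eq_zero
  have he : ((if Even n then a else b) + a) * ((if Even n then a else b) + b) = 0 := by
    split_ifs <;> simp [CharTwo.add_self_eq_zero]
  have hu' : u (n + 1) = (if Even n then a else b) * u n ^ 2 := by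
    rw [hu, hu, continuant_pdWord_succ]
  have hv' : v (n + 1) = (if Even n then a else b) * u n * v n + 1 := by
    rw [hv, hu, hv, continuant_tail_pdWord_succ a b hn]
  rw [hX, hX, hu', hv']
  generalize (if Even n then a else b) = e at *
  generalize u n = x at *
  generalize v n = y at *
  linear_combination e ^ 2 * x ^ 4 * he + (1 + a * b * e ^ 3 * x ^ 5 * y
    + 2 * e ^ 3 * x ^ 3 * y ^ 3 + 3 * e ^ 2 * x ^ 2 * y ^ 2 + 2 * e * x * y - e ^ 4 * x ^ 4
    - e ^ 3 * x ^ 4 * (a + b)) * h2
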